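/- arXiv:1306.1657 — 2 statements merged into one kernel-verified Lean document; each statement's English description precedes it below -/
import Mathlib

section
/- Let ℓ ∈ ℕ and for each 1 ≤ k ≤ ℓ let N_k ∈ ℕ, let (λ_{k,n})_{n=1}^{N_k} be real numbers and (r_{k,n})_{n=1}^{N_k} complex numbers, and set P_k(y) = ∑_{n=1}^{N_k} r_{k,n} e^{iλ_{k,n} y} for y ∈ ℝ. If P_k(y) ∈ ℝ for all y ∈ ℝ and all k, then the vector-valued function P(y) = (P_1(y), …, P_ℓ(y)), restricted to [0,∞), has a limiting distribution on ℝ^ℓ. -/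
open MeasureTheory Filter Topology

/-- A vector-valued function `Φ : ℝ → ℝ^ℓ` possesses a limiting distribution. -/
def HasLimitingDistVec {ℓ : ℕ} (Φ : ℝ → (Fin ℓ → ℝ)) : Prop :=
  ∃ μ : Measure (Fin ℓ → ℝ), IsProbabilityMeasure μ ∧
    ∀ f : BoundedContinuousFunction (Fin ℓ → ℝ) ℝ,
      Tendsto (fun Y : ℝ => (1 / Y) * ∫ y in (0:ℝ)..Y, f (Φ y)) atTop
        (𝓝 (∫ x, f x ∂μ))

/-- The uniform probability measure on `(0, max Y 1]`. -/
noncomputable def uniformIoc (Y : ℝ) : ProbabilityMeasure ℝ :=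
  ⟨ProbabilityTheory.cond volume (Set.Ioc 0 (max Y 1)),
    ProbabilityTheory.cond_isProbabilityMeasure_of_finite (by simp) (by simp)⟩

lemma integral_uniformIoc {E : Type*} [NormedAddCommGroup E] [NormedSpace ℝ E]
    {Y : ℝ} (hY : 1 ≤ Y) (f : ℝ → E) :
    ∫ y, f y ∂(uniformIoc Y : Measure ℝ) = (1 / Y) • ∫ y in (0 : ℝ)..Y, f y := by
  have hY0 : 0 ≤ Y := zero_le_one.trans hY
  simp [uniformIoc, ProbabilityTheory.cond, max_eq_left hY, intervalIntegral.integral_of_le hY0,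
    integral_smul_measure, ENNReal.toReal_inv, ENNReal.toReal_ofReal hY0]

lemma tendsto_integral_uniformIoc_exp {θ : ℝ} (hθ : θ ≠ 0) :
    Tendsto (fun Y => ∫ y, Complex.exp (θ * Complex.I * (y : ℝ)) ∂(uniformIoc Y : Measure ℝ))
      atTop (𝓝 0) := by
  have hc : (θ * Complex.I : ℂ) ≠ 0 := by simp [hθ]
  have hlim : Tendsto (fun Y : ℝ => Y⁻¹ * (2 / |θ|)) atTop (𝓝 0) := by
    simpa using tendsto_inv_atTop_zero.mul_const (2 / |θ|)
  refine squeeze_zero_norm' ?_ hlim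
  filter_upwards [eventually_ge_atTop 1] with Y hY
  have hY0 : 0 ≤ Y := zero_le_one.trans hY
  rw [integral_uniformIoc hY, integral_exp_mul_complex hc, norm_smul]
  have hnum : ‖Complex.exp (θ * Complex.I * Y) - Complex.exp (θ * Complex.I * (0 : ℝ))‖ ≤ 2 := by
    refine (norm_sub_le _ _).trans (le_of_eq ?_)
    have h : (θ * Complex.I * Y : ℂ) = ((θ * Y : ℝ) : ℂ) * Complex.I := by push_cast; ring
    rw [h, Complex.norm_exp_ofReal_mul_I]
    norm_num
  simp only [norm_div, norm_mul, norm_inv, Complex.norm_I, Complex.norm_real, Real.norm_eq_abs, mul_one, one_div,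
    abs_of_nonneg hY0]
  gcongr

/-- The line of direction `ω` through the origin of the torus. -/
noncomputable def torusLine {d : Type*} (ω : d → ℝ) (y : ℝ) : UnitAddTorus d :=
  fun i => ((ω i * y : ℝ) : UnitAddCircle)

@[fun_prop]
lemma continuous_torusLine {d : Type*} (ω : d → ℝ) : Continuous (torusLine ω) :=
  continuous_pi fun i => (AddCircle.continuous_mk' 1).comp (by fun_prop)

lemma mFourier_torusLine {d : Type*} [Fintype d] (ω : d → ℝ) (n : d → ℤ) (y : ℝ) :
    UnitAddTorus.mFourier n (torusLine ω y) =
      Complex.exp ((2 * Real.pi * ∑ i, n i * ω i : ℝ) * Complex.I * y) := by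
  simp only [UnitAddTorus.mFourier, ContinuousMap.coe_mk, torusLine, fourier_coe_apply,
    ← Complex.exp_sum]
  congr 1
  push_cast
  rw [Finset.mul_sum, Finset.sum_mul, Finset.sum_mul]
  exact Finset.sum_congr rfl fun i _ => by ring

/-- The time averages of a monomial along a line of the torus converge. -/
lemma exists_tendsto_integral_mFourier_torusLine {d : Type*} [Fintype d] (ω : d → ℝ)
    (n : d → ℤ) :
    ∃ L : ℂ, Tendsto (fun Y => ∫ y, UnitAddTorus.mFourier n (torusLine ω y)
      ∂(uniformIoc Y : Measure ℝ)) atTop (𝓝 L) := by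
  simp_rw [mFourier_torusLine]
  by_cases hθ : 2 * Real.pi * ∑ i, n i * ω i = 0
  · exact ⟨1, by simp [hθ]⟩
  · exact ⟨0, tendsto_integral_uniformIoc_exp hθ⟩

/-- The time averages along a line of the torus converge weakly. -/
lemma exists_tendsto_map_torusLine {d : Type*} [Fintype d] (ω : d → ℝ) :
    ∃ ν : ProbabilityMeasure (UnitAddTorus d),
      Tendsto (fun Y => (uniformIoc Y).map (continuous_torusLine ω).aemeasurable) atTop
        (𝓝 ν) := by
  set m : ℝ → ProbabilityMeasure (UnitAddTorus d) :=
    fun Y => (uniformIoc Y).map (continuous_torusLine ω).aemeasurable with hm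
  let U : Ultrafilter ℝ := Ultrafilter.of atTop
  have hU : (U : Filter ℝ) ≤ atTop := Ultrafilter.of_le _
  refine ⟨(U.map m).lim, ?_⟩
  have hν : Tendsto m U (𝓝 (U.map m).lim) := (U.map m).le_nhds_lim
  generalize (U.map m).lim = ν at hν ⊢
  have hint (g : C(UnitAddTorus d, ℂ)) (Y : ℝ) :
      ∫ x, g x ∂(m Y : Measure (UnitAddTorus d)) =
        ∫ y, g (torusLine ω y) ∂(uniformIoc Y : Measure ℝ) := by
    rw [hm, ProbabilityMeasure.toMeasure_map, integral_map
      (continuous_torusLine ω).aemeasurable g.continuous.aestronglyMeasurable]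
  have hintegrable (g : C(UnitAddTorus d, ℂ)) (κ : ProbabilityMeasure (UnitAddTorus d)) :
      Integrable g (κ : Measure (UnitAddTorus d)) :=
    (BoundedContinuousFunction.mkOfCompact g).integrable _
  have hmono (n : d → ℤ) :
      Tendsto (fun Y => ∫ x, UnitAddTorus.mFourier n x ∂(m Y : Measure (UnitAddTorus d))) atTop
        (𝓝 (∫ x, UnitAddTorus.mFourier n x ∂(ν : Measure (UnitAddTorus d)))) := by
    obtain ⟨L, hL⟩ := exists_tendsto_integral_mFourier_torusLine ω n
    simp_rw [← hint] at hL
    have h := (ProbabilityMeasure.tendsto_iff_forall_integral_rclike_tendsto ℂ).1 hν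
      (BoundedContinuousFunction.mkOfCompact (UnitAddTorus.mFourier n))
    exact tendsto_nhds_unique (hL.mono_left hU) h ▸ hL
  have hsub (g : C(UnitAddTorus d, ℂ)) (hg : g ∈ UnitAddTorus.mFourierSubalgebra d) :
      Tendsto (fun Y => ∫ x, g x ∂(m Y : Measure (UnitAddTorus d))) atTop
        (𝓝 (∫ x, g x ∂(ν : Measure (UnitAddTorus d)))) := by
    replace hg : g ∈ Submodule.span ℂ (Set.range (UnitAddTorus.mFourier (d := d))) := by
      rw [← UnitAddTorus.mFourierSubalgebra_coe]
      exact hg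
    induction hg using Submodule.span_induction with
    | mem x hx =>
      obtain ⟨n, rfl⟩ := hx
      exact hmono n
    | zero => simp
    | add x y _ _ hx hy =>
      simp only [ContinuousMap.add_apply]
      simp_rw [integral_add (hintegrable x _) (hintegrable y _)]
      exact hx.add hy
    | smul a x _ hx =>
      simp only [ContinuousMap.smul_apply, integral_smul]
      exact hx.const_smul a
  refine ProbabilityMeasure.tendsto_of_tight_of_separatesPoints ℂ
    .of_compactSpace
    (A := (UnitAddTorus.mFourierSubalgebra d).comap
      (BoundedContinuousFunction.toContinuousMapStarₐ ℂ)) ?_ fun g hg => hsub _ hg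
  intro x y hxy
  obtain ⟨_, ⟨g, hg, rfl⟩, hgxy⟩ := UnitAddTorus.mFourierSubalgebra_separatesPoints hxy
  exact ⟨g, ⟨g, ⟨BoundedContinuousFunction.mkOfCompact g, hg, rfl⟩, rfl⟩, hgxy⟩

/-- A continuous function of a line on the torus possesses a limiting distribution. -/
lemma hasLimitingDistVec_comp_torusLine {d : Type*} [Fintype d] (ω : d → ℝ) {ℓ : ℕ}
    {F : UnitAddTorus d → Fin ℓ → ℝ} (hF : Continuous F) :
    HasLimitingDistVec (F ∘ torusLine ω) := by
  obtain ⟨ν, hν⟩ := exists_tendsto_map_torusLine ω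
  refine ⟨ν.map hF.aemeasurable, inferInstance, fun f => ?_⟩
  have h := (ProbabilityMeasure.tendsto_iff_forall_integral_tendsto).1 hν
    (f.compContinuous ⟨F, hF⟩)
  rw [ProbabilityMeasure.toMeasure_map,
    integral_map hF.aemeasurable f.continuous.aestronglyMeasurable]
  refine h.congr' ?_
  filter_upwards [eventually_ge_atTop 1] with Y hY
  rw [ProbabilityMeasure.toMeasure_map, integral_map (continuous_torusLine ω).aemeasurable
    (BoundedContinuousFunction.continuous _).aestronglyMeasurable, integral_uniformIoc hY]
  rfl

/-- A vector of real-valued trigonometric polynomials possesses a limiting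
distribution. -/
theorem statement6
    (ℓ : ℕ) (N : Fin ℓ → ℕ)
    (lam : (k : Fin ℓ) → Fin (N k) → ℝ) (r : (k : Fin ℓ) → Fin (N k) → ℂ)
    (hreal : ∀ (k : Fin ℓ) (y : ℝ),
      (∑ n, r k n * Complex.exp (Complex.I * (lam k n * y))).im = 0) :
    HasLimitingDistVec
      (fun y k => (∑ n, r k n * Complex.exp (Complex.I * (lam k n * y))).re) := by
  let F : UnitAddTorus (Σ k, Fin (N k)) → Fin ℓ → ℝ :=
    fun x k => (∑ n, r k n * fourier 1 (x ⟨k, n⟩)).re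
  have hF : Continuous F := by fun_prop
  convert hasLimitingDistVec_comp_torusLine
    (fun i : Σ k, Fin (N k) => lam i.1 i.2 / (2 * Real.pi)) hF using 1
  funext y k
  simp only [F, Function.comp_apply, torusLine, fourier_coe_apply]
  congr! 4 with n
  push_cast
  field_simp
end

section
/- Let t_1, …, t_N be arbitrary real numbers. Let A be the topological closure in the torus 𝕋^N = ℝ^N/ℤ^N of the one-parameter subgroup {y(t_1,…,t_N) mod ℤ^N : y ∈ ℝ}, and let ω be the normalized Haar measure on the compact subgroup A. Let g : ℝ^N → ℝ be a continuous function of period 1 in each of its variables. Then lim_{Y→∞} (1/Y)∫_0^Y g(y t_1, …, y t_N) dy = ∫_A g dω. -/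
open MeasureTheory Filter Topology

/-- For a continuous curve `φ` in a compact space, the continuous functions whose averages along
`φ` converge to their integral against a probability measure form a closed subspace. -/
theorem tendsto_average_of_mem_closure_span {X : Type*} [TopologicalSpace X] [CompactSpace X]
    [MeasurableSpace X] [OpensMeasurableSpace X] {φ : ℝ → X} (hφ : Continuous φ)
    (ω : Measure X) [IsProbabilityMeasure ω] {S : Set C(X, ℂ)}
    (hS : ∀ f ∈ S, Tendsto (fun Y : ℝ => (Y : ℂ)⁻¹ * ∫ y in (0 : ℝ)..Y, f (φ y)) atTop
      (𝓝 (∫ x, f x ∂ω)))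
    {f : C(X, ℂ)} (hf : f ∈ (Submodule.span ℂ S).topologicalClosure) :
    Tendsto (fun Y : ℝ => (Y : ℂ)⁻¹ * ∫ y in (0 : ℝ)..Y, f (φ y)) atTop
      (𝓝 (∫ x, f x ∂ω)) := by
  have hint : ∀ f : C(X, ℂ), Integrable f ω := fun f =>
    Integrable.of_bound f.continuous.aestronglyMeasurable ‖f‖
      (Eventually.of_forall f.norm_coe_le_norm)
  have hii : ∀ (f : C(X, ℂ)) (a b : ℝ), IntervalIntegrable (fun y => f (φ y)) volume a b :=
    fun f a b => (f.continuous.comp hφ).intervalIntegrable a b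
  have hspan : ∀ h ∈ Submodule.span ℂ S,
      Tendsto (fun Y : ℝ => (Y : ℂ)⁻¹ * ∫ y in (0 : ℝ)..Y, h (φ y)) atTop
        (𝓝 (∫ x, h x ∂ω)) := by
    intro h hh
    induction hh using Submodule.span_induction with
    | mem h hh => exact hS h hh
    | zero => simp
    | add u v _ _ hu hv =>
      simp only [ContinuousMap.add_apply]
      rw [integral_add (hint u) (hint v)]
      refine (hu.add hv).congr fun Y => ?_
      rw [intervalIntegral.integral_add (hii u 0 Y) (hii v 0 Y), mul_add]
    | smul c u _ hu =>
      simp only [ContinuousMap.smul_apply, smul_eq_mul]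
      rw [integral_const_mul]
      refine (hu.const_mul c).congr fun Y => ?_
      rw [intervalIntegral.integral_const_mul, mul_left_comm]
  rw [Metric.tendsto_nhds]
  intro ε hε
  obtain ⟨h, hh, hfh⟩ := Metric.mem_closure_iff.mp hf (ε / 3) (by positivity)
  rw [dist_eq_norm] at hfh
  have hpt : ∀ x, ‖f x - h x‖ ≤ ‖f - h‖ := (f - h).norm_coe_le_norm
  have hω : ‖∫ x, f x ∂ω - ∫ x, h x ∂ω‖ ≤ ‖f - h‖ := by
    rw [← integral_sub (hint f) (hint h)]
    simpa using norm_integral_le_of_norm_le_const (μ := ω) (Eventually.of_forall hpt)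
  filter_upwards [Metric.tendsto_nhds.mp (hspan h hh) (ε / 3) (by positivity),
    eventually_gt_atTop 0] with Y hY hY0
  have havg : ‖(Y : ℂ)⁻¹ * (∫ y in (0 : ℝ)..Y, f (φ y)) -
      (Y : ℂ)⁻¹ * ∫ y in (0 : ℝ)..Y, h (φ y)‖ ≤ ‖f - h‖ := by
    rw [← mul_sub, ← intervalIntegral.integral_sub (hii f 0 Y) (hii h 0 Y), norm_mul, norm_inv,
      Complex.norm_real, Real.norm_of_nonneg hY0.le, inv_mul_le_iff₀ hY0, mul_comm]
    simpa [abs_of_pos hY0] using intervalIntegral.norm_integral_le_of_norm_le_const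
      (a := 0) (b := Y) (f := fun y => f (φ y) - h (φ y)) fun y _ => hpt (φ y)
  rw [dist_eq_norm] at hY ⊢
  calc _ = ‖((Y : ℂ)⁻¹ * (∫ y in (0 : ℝ)..Y, f (φ y)) - (Y : ℂ)⁻¹ * ∫ y in (0 : ℝ)..Y, h (φ y)) +
        ((Y : ℂ)⁻¹ * (∫ y in (0 : ℝ)..Y, h (φ y)) - ∫ x, h x ∂ω) -
        (∫ x, f x ∂ω - ∫ x, h x ∂ω)‖ := by congr 1; ring
    _ ≤ _ := (norm_sub_le _ _).trans (add_le_add_left (norm_add_le _ _) _)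
    _ < ε := by linarith

theorem tendsto_average_exp {c : ℝ} (hc : c ≠ 0) :
    Tendsto (fun Y : ℝ => (Y : ℂ)⁻¹ * ∫ y in (0 : ℝ)..Y, Complex.exp (c * Complex.I * y)) atTop
      (𝓝 0) := by
  have hc' : (c : ℂ) * Complex.I ≠ 0 := by simp [hc]
  rw [tendsto_zero_iff_norm_tendsto_zero]
  have hlim : Tendsto (fun Y : ℝ => |Y|⁻¹ * (2 / |c|)) atTop (𝓝 0) := by
    simpa using (tendsto_inv_atTop_zero.comp tendsto_abs_atTop_atTop).mul_const (2 / |c|)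
  refine squeeze_zero (fun _ => norm_nonneg _) (fun Y => ?_) hlim
  rw [integral_exp_mul_complex hc', norm_mul, norm_inv, Complex.norm_real, Real.norm_eq_abs,
    norm_div, norm_mul, Complex.norm_I, Complex.norm_real, Real.norm_eq_abs, mul_one]
  gcongr
  refine (norm_sub_le _ _).trans ?_
  have hnorm : ∀ y : ℝ, ‖Complex.exp (c * Complex.I * y)‖ = 1 := fun y => by
    rw [← Complex.norm_exp_ofReal_mul_I (c * y)]
    congr 2
    push_cast
    ring
  rw [hnorm, hnorm]
  norm_num

namespace UnitAddTorus

/-- A continuous function on `d → ℝ` with period `1` in each variable descends to the torus. -/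
theorem continuous_of_comp_coe {d E : Type*} [TopologicalSpace E] {f : UnitAddTorus d → E}
    (hf : Continuous fun x : d → ℝ => f fun i => (x i : UnitAddCircle)) : Continuous f := by
  have hq : IsOpenQuotientMap
      (Pi.map (fun (_ : d) (x : ℝ) => (x : UnitAddCircle))) :=
    .piMap fun _ => QuotientAddGroup.isOpenQuotientMap_mk
  exact hq.continuous_comp_iff.mp hf

variable {d : Type*} [Fintype d]

theorem mFourier_apply_add (n : d → ℤ) (a x : UnitAddTorus d) :
    mFourier n (a + x) = mFourier n a * mFourier n x := by
  simp [mFourier, fourier_apply, smul_add, AddCircle.toCircle_add, Finset.prod_mul_distrib]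

theorem mFourier_apply_line (n : d → ℤ) (t : d → ℝ) (y : ℝ) :
    mFourier n (fun i => ((y * t i : ℝ) : UnitAddCircle)) =
      Complex.exp ((2 * Real.pi * ∑ i, n i * t i : ℝ) * Complex.I * y) := by
  simp only [mFourier, ContinuousMap.coe_mk, fourier_coe_apply]
  rw [← Complex.exp_sum]
  congr 1
  push_cast
  rw [Finset.mul_sum, Finset.sum_mul, Finset.sum_mul]
  refine Finset.sum_congr rfl fun i _ => ?_
  simp only [div_one]
  ring

theorem tendsto_average_mFourier (t : d → ℝ) (ω : Measure (UnitAddTorus d))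
    [IsProbabilityMeasure ω]
    (hsupp : ω (closure (Set.range fun (y : ℝ) (i : d) => ((y * t i : ℝ) : UnitAddCircle)))ᶜ = 0)
    (hinv : ∀ y : ℝ,
      Measure.map (fun x => (fun i => ((y * t i : ℝ) : UnitAddCircle)) + x) ω = ω)
    (n : d → ℤ) :
    Tendsto (fun Y : ℝ => (Y : ℂ)⁻¹ *
        ∫ y in (0 : ℝ)..Y, mFourier n fun i => ((y * t i : ℝ) : UnitAddCircle)) atTop
      (𝓝 (∫ x, mFourier n x ∂ω)) := by
  by_cases hs : ∑ i, n i * t i = 0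
  · have hline : ∀ y : ℝ, mFourier n (fun i => ((y * t i : ℝ) : UnitAddCircle)) = 1 := fun y => by
      rw [mFourier_apply_line, hs]
      simp
    have hclosure : Set.EqOn (mFourier n) (fun _ => 1)
        (closure (Set.range fun (y : ℝ) (i : d) => ((y * t i : ℝ) : UnitAddCircle))) :=
      Set.EqOn.closure (by rintro _ ⟨y, rfl⟩; exact hline y) (mFourier n).continuous
        continuous_const
    have hae : mFourier n =ᵐ[ω] fun _ => 1 :=
      measure_mono_null (fun x hx hxA => hx (hclosure hxA)) hsupp
    rw [integral_congr_ae hae]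
    simp only [hline, integral_const, intervalIntegral.integral_const, probReal_univ, sub_zero,
      one_smul]
    refine tendsto_const_nhds.congr' ?_
    filter_upwards [eventually_ne_atTop 0] with Y hY
    simp [hY]
  · have hzero : ∫ x, mFourier n x ∂ω = 0 := by
      set y : ℝ := (2 * ∑ i, n i * t i)⁻¹ with hy
      have hline : mFourier n (fun i => ((y * t i : ℝ) : UnitAddCircle)) = -1 := by
        rw [mFourier_apply_line, ← Complex.exp_pi_mul_I]
        congr 1
        have hval : 2 * Real.pi * (∑ i, n i * t i) * y = Real.pi := by
          rw [hy]
          field_simp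
        rw [mul_right_comm, ← Complex.ofReal_mul, hval]
      have hmap : ∫ x, mFourier n x ∂ω = -∫ x, mFourier n x ∂ω := by
        conv_lhs => rw [← hinv y]
        rw [integral_map (by fun_prop) (mFourier n).continuous.aestronglyMeasurable]
        simp only [mFourier_apply_add, hline, neg_one_mul, integral_neg]
      exact self_eq_neg.mp hmap
    rw [hzero]
    simp only [mFourier_apply_line]
    exact tendsto_average_exp (mul_ne_zero (by positivity) hs)

end UnitAddTorus

/-- Kronecker–Weyl equidistribution theorem: for arbitrary reals `t₁, …, t_N`, the
time-average of a continuous function of period `1` in each variable along the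
one-parameter flow `y ↦ (y t₁, …, y t_N)` converges to the integral over the closure
`A` of the flow in the torus `𝕋^N`, with respect to the normalized Haar measure `ω` on
`A` (characterized as the unique probability measure carried by `A` and invariant under
translation by every element of `A`). -/
theorem statement7
    (N : ℕ) (t : Fin N → ℝ)
    (A : Set (Fin N → AddCircle (1:ℝ)))
    (hA : A = closure (Set.range (fun y : ℝ => fun i : Fin N =>
      ((y * t i : ℝ) : AddCircle (1:ℝ)))))
    (ω : Measure (Fin N → AddCircle (1:ℝ)))
    (hωprob : IsProbabilityMeasure ω)
    (hωsupp : ω Aᶜ = 0)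
    (hωinv : ∀ a ∈ A, Measure.map (fun x => a + x) ω = ω)
    (g : (Fin N → ℝ) → ℝ) (hg : Continuous g)
    (hper : ∀ (x : Fin N → ℝ) (i : Fin N), g (Function.update x i (x i + 1)) = g x)
    (gbar : (Fin N → AddCircle (1:ℝ)) → ℝ)
    (hgbar : ∀ x : Fin N → ℝ, gbar (fun i => ((x i : ℝ) : AddCircle (1:ℝ))) = g x) :
    Tendsto (fun Y : ℝ => (1 / Y) * ∫ y in (0:ℝ)..Y, g (fun i => y * t i)) atTop
      (𝓝 (∫ a, gbar a ∂ω)) := by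
  have hmem : ∀ y : ℝ, (fun i => ((y * t i : ℝ) : AddCircle (1:ℝ))) ∈ A := fun y =>
    hA ▸ subset_closure ⟨y, rfl⟩
  have hφ : Continuous fun (y : ℝ) (i : Fin N) => ((y * t i : ℝ) : AddCircle (1:ℝ)) :=
    continuous_pi fun i => continuous_quotient_mk'.comp (continuous_id.mul continuous_const)
  have hcont : Continuous gbar :=
    UnitAddTorus.continuous_of_comp_coe (hg.congr fun x => (hgbar x).symm)
  let G : C(UnitAddTorus (Fin N), ℂ) :=
    ⟨fun x => (gbar x : ℂ), Complex.continuous_ofReal.comp hcont⟩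
  have hlim := tendsto_average_of_mem_closure_span hφ ω (f := G)
    (S := Set.range UnitAddTorus.mFourier)
    (by
      rintro _ ⟨n, rfl⟩
      exact UnitAddTorus.tendsto_average_mFourier t ω (hA ▸ hωsupp) (fun y => hωinv _ (hmem y)) n)
    (by rw [UnitAddTorus.span_mFourier_closure_eq_top]; trivial)
  have hre := (Complex.continuous_re.tendsto _).comp hlim
  simp only [G, ContinuousMap.coe_mk, integral_complex_ofReal, Complex.ofReal_re] at hre
  refine hre.congr fun Y => ?_
  simp only [Function.comp_apply, intervalIntegral.integral_ofReal, hgbar fun i => _ * t i]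
  rw [← Complex.ofReal_inv, ← Complex.ofReal_mul, Complex.ofReal_re, one_div]
end
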